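/- arXiv:2112.12185 — 7 statements merged into one kernel-verified Lean document; each statement's English description precedes it below -/
import Mathlib

section
/- Let X and Y be standard Borel (Polish) spaces, ν₀ a probability measure on X, T : X → Y measurable, and Φ̄ : Y → ℝ measurable with Z := ∫_X exp(−Φ̄(T(x))) ν₀(dx) ∈ (0, ∞). Define ν on X by dν/dν₀(x) = Z⁻¹ exp(−Φ̄(T(x))). Let ν₀_{|T} be a regular conditional distribution of X₀ ∼ ν₀ given T(X₀). Then ν₀_{|T} is also a regular conditional distribution of X ∼ ν given T(X); that is, for all measurable A ⊆ X and B ⊆ Y, ν(A ∩ T⁻¹(B)) = ∫_{T⁻¹(B)} ν₀_{|T}(T(x), A) ν(dx). -/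
open MeasureTheory ProbabilityTheory

/-- Reweighting a measure by a measurable function of `T` preserves the conditional distribution
identity given `T`. -/
theorem withDensity_comp_inter_preimage {X Y : Type*} [MeasurableSpace X] [MeasurableSpace Y]
    {μ : Measure X} {T : X → Y} (hT : Measurable T) {g : Y → ENNReal} (hg : Measurable g)
    {k : Y → ENNReal} (hk : Measurable k) {A : Set X} (hA : MeasurableSet A)
    (h : ∀ B, MeasurableSet B → μ (A ∩ T ⁻¹' B) = ∫⁻ y in B, k y ∂(μ.map T))
    {B : Set Y} (hB : MeasurableSet B) :
    μ.withDensity (fun x => g (T x)) (A ∩ T ⁻¹' B) =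
      ∫⁻ x in T ⁻¹' B, k (T x) ∂(μ.withDensity fun x => g (T x)) := by
  have hmap : (μ.restrict A).map T = (μ.map T).withDensity k := by
    ext C hC
    rw [Measure.map_apply hT hC, Measure.restrict_apply (hT hC), withDensity_apply _ hC,
      Set.inter_comm, h C hC]
  have hTB := hT hB
  calc μ.withDensity (fun x => g (T x)) (A ∩ T ⁻¹' B)
      = ∫⁻ x in T ⁻¹' B, g (T x) ∂(μ.restrict A) := by
        rw [withDensity_apply _ (hA.inter hTB), Measure.restrict_restrict hTB, Set.inter_comm]
    _ = ∫⁻ y in B, g y ∂((μ.map T).withDensity k) := by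
        rw [← setLIntegral_map hB hg hT, hmap]
    _ = ∫⁻ x in T ⁻¹' B, k (T x) * g (T x) ∂μ := by
        rw [setLIntegral_withDensity_eq_setLIntegral_mul _ hk hg hB,
          setLIntegral_map hB (hk.mul hg) hT]
        simp only [Pi.mul_apply, mul_comm]
    _ = ∫⁻ x in T ⁻¹' B, k (T x) ∂(μ.withDensity fun x => g (T x)) := by
        simp_rw [mul_comm (k _)]
        exact (setLIntegral_withDensity_eq_setLIntegral_mul μ (hg.comp hT) (hk.comp hT) hTB).symm

/-- **Regular conditional distributions are preserved under reweighting by a function of `T`.**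
If `ν` has density `Z⁻¹ exp (-Φ̄ ∘ T)` with respect to `ν₀` and `κ` is a regular conditional
distribution of `X₀ ∼ ν₀` given `T X₀`, then `κ` is also a regular conditional distribution of
`X ∼ ν` given `T X`. -/
theorem rcd_invariant_under_reweighting {X Y : Type*}
    [MeasurableSpace X] [StandardBorelSpace X]
    [MeasurableSpace Y] [StandardBorelSpace Y]
    (ν₀ : Measure X) [IsProbabilityMeasure ν₀]
    (T : X → Y) (hT : Measurable T)
    (Φ : Y → ℝ) (hΦ : Measurable Φ)
    (hInt : Integrable (fun x => Real.exp (-(Φ (T x)))) ν₀)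
    (Z : ℝ) (hZ : Z = ∫ x, Real.exp (-(Φ (T x))) ∂ν₀) (hZpos : 0 < Z)
    (ν : Measure X)
    (hν : ν = ν₀.withDensity (fun x => ENNReal.ofReal (Z⁻¹ * Real.exp (-(Φ (T x))))))
    (κ : Kernel Y X) [IsMarkovKernel κ]
    (hκ : ∀ (A : Set X) (B : Set Y), MeasurableSet A → MeasurableSet B →
      ν₀ (A ∩ T ⁻¹' B) = ∫⁻ y in B, κ y A ∂(ν₀.map T)) :
    ∀ (A : Set X) (B : Set Y), MeasurableSet A → MeasurableSet B →
      ν (A ∩ T ⁻¹' B) = ∫⁻ x in T ⁻¹' B, κ (T x) A ∂ν := by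
  intro A B hA hB
  subst hν
  have hg : Measurable fun y => ENNReal.ofReal (Z⁻¹ * Real.exp (-(Φ y))) := by fun_prop
  exact withDensity_comp_inter_preimage hT hg (κ.measurable_coe hA) hA
    (fun C hC => hκ A C hA hC) hB
end

section
/- Let d ≥ 1, let C ∈ ℝ^{d×d} be symmetric positive definite, and let ν₀ be the centred Gaussian measure on ℝᵈ with Lebesgue density x ↦ (2π)^{−d/2} (det C)^{−1/2} exp(−½ xᵀC⁻¹x). For each x̄ on the unit sphere S^{d−1}, let γ_{x̄} be the Gamma distribution on (0,∞) with shape parameter d/2 and rate parameter ½ x̄ᵀC⁻¹x̄, and let κ(x̄, ·) be the push-forward of γ_{x̄} under the map t ↦ √t · x̄. Then κ is a regular conditional distribution of X₀ ∼ ν₀ given Π^S(X₀); that is, for all Borel A ⊆ ℝᵈ and Borel B ⊆ S^{d−1}, ν₀(A ∩ (Π^S)⁻¹(B)) = ∫_B κ(x̄, A) (Π^S♯ν₀)(dx̄). -/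
open MeasureTheory
open scoped Classical

/-- The radial projection onto the unit sphere, sending `0` to a fixed point `z`. -/
noncomputable def radialProj {E : Type*} [NormedAddCommGroup E] [NormedSpace ℝ E]
    (z : E) (x : E) : E :=
  if x = 0 then z else ‖x‖⁻¹ • x

open ProbabilityTheory Set

lemma measurable_radialProj {E : Type*} [NormedAddCommGroup E] [NormedSpace ℝ E]
    [MeasurableSpace E] [BorelSpace E] [SecondCountableTopology E] (z : E) :
    Measurable (radialProj z) :=
  Measurable.ite (measurableSet_singleton 0) measurable_const
    (measurable_norm.inv.smul measurable_id)

lemma radialProj_smul_of_pos {E : Type*} [NormedAddCommGroup E] [NormedSpace ℝ E]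
    (z : E) {x : E} (hx : ‖x‖ = 1) {r : ℝ} (hr : 0 < r) : radialProj z (r • x) = x := by
  have hx0 : x ≠ 0 := by
    rintro rfl
    simp at hx
  rw [radialProj, if_neg (smul_ne_zero hr.ne' hx0), norm_smul, hx, Real.norm_of_nonneg hr.le,
    mul_one, inv_smul_smul₀ hr.ne']

/-- Polar coordinates for the Lebesgue integral of a nonnegative function. -/
lemma lintegral_eq_lintegral_toSphere_Ioi {E : Type*} [NormedAddCommGroup E] [NormedSpace ℝ E]
    [MeasurableSpace E] [BorelSpace E] [FiniteDimensional ℝ E] [Nontrivial E]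
    (μ : Measure E) [μ.IsAddHaarMeasure] {f : E → ENNReal} (hf : Measurable f) :
    ∫⁻ x, f x ∂μ = ∫⁻ s : Metric.sphere (0 : E) 1, (∫⁻ r in Ioi (0 : ℝ),
      ENNReal.ofReal (r ^ (Module.finrank ℝ E - 1)) * f (r • (s : E))) ∂μ.toSphere := by
  have hF : Measurable fun p : Metric.sphere (0 : E) 1 × Ioi (0 : ℝ) =>
      f ((p.2 : ℝ) • (p.1 : E)) := by fun_prop
  have key := (Measure.measurePreserving_homeomorphUnitSphereProd μ).lintegral_comp hF
  calc ∫⁻ x, f x ∂μ = ∫⁻ x : ({(0)}ᶜ : Set E), f x ∂(μ.comap (↑)) := by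
        rw [lintegral_subtype_comap (measurableSet_singleton _).compl,
          restrict_compl_singleton]
    _ = ∫⁻ p, f ((p.2 : ℝ) • (p.1 : E))
          ∂(μ.toSphere.prod (Measure.volumeIoiPow (Module.finrank ℝ E - 1))) := by
        rw [← key]
        refine lintegral_congr fun x => ?_
        have hx : ‖(x : E)‖ ≠ 0 := norm_ne_zero_iff.2 x.2
        simp [smul_inv_smul₀ hx]
    _ = _ := by
        rw [lintegral_prod _ hF.aemeasurable]
        refine lintegral_congr fun s => ?_
        rw [Measure.volumeIoiPow, lintegral_withDensity_eq_lintegral_mul _ (by fun_prop)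
          (by fun_prop)]
        exact lintegral_subtype_comap measurableSet_Ioi
          (fun r : ℝ => ENNReal.ofReal (r ^ (Module.finrank ℝ E - 1)) * f (r • (s : E)))

/-- The substitution `t = r ^ 2` on the positive half-line. -/
lemma lintegral_Ioi_comp_sq (h : ℝ → ENNReal) :
    ∫⁻ t in Ioi (0 : ℝ), h t = ∫⁻ r in Ioi (0 : ℝ), ENNReal.ofReal (2 * r) * h (r ^ 2) := by
  have him : (fun r : ℝ => r ^ 2) '' Ioi 0 = Ioi 0 := by
    ext t
    constructor
    · rintro ⟨r, hr, rfl⟩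
      exact pow_pos (mem_Ioi.1 hr) 2
    · intro ht
      exact ⟨√t, Real.sqrt_pos.2 ht, Real.sq_sqrt (le_of_lt ht)⟩
  have hinj : InjOn (fun r : ℝ => r ^ 2) (Ioi 0) := fun a ha b hb hab =>
    (pow_left_inj₀ (le_of_lt ha) (le_of_lt hb) two_ne_zero).1 hab
  have := lintegral_image_eq_lintegral_abs_deriv_mul (s := Ioi 0) (f := fun r : ℝ => r ^ 2)
    (f' := fun r => 2 * r) measurableSet_Ioi
    (fun x _ => by simpa using (hasDerivAt_pow 2 x).hasDerivWithinAt) hinj h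
  rw [him] at this
  rw [this]
  refine setLIntegral_congr_fun measurableSet_Ioi fun r hr => ?_
  rw [abs_of_pos (by linarith [mem_Ioi.1 hr])]

lemma lintegral_gammaMeasure (a q : ℝ) {h : ℝ → ENNReal} (hh : Measurable h) :
    ∫⁻ t, h t ∂gammaMeasure a q = ∫⁻ t in Ioi (0 : ℝ), gammaPDF a q t * h t := by
  have hpdf : Measurable (gammaPDF a q) := (measurable_gammaPDFReal a q).ennreal_ofReal
  rw [gammaMeasure, lintegral_withDensity_eq_lintegral_mul _ hpdf hh,
    setLIntegral_congr Ioi_ae_eq_Ici]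
  symm
  apply setLIntegral_eq_of_support_subset
  intro t ht
  by_contra htn
  exact ht (by simp [gammaPDF_of_neg (not_le.1 htn)])

/-- A radial Gaussian integral in dimension `d` is a multiple of an expectation under a
Gamma distribution with shape `d / 2`. -/
lemma lintegral_pow_mul_exp_neg_sq_eq_gammaMeasure {d : ℕ} (hd : 1 ≤ d) {K q : ℝ} (hK : 0 ≤ K)
    (hq : 0 < q) {h : ℝ → ENNReal} (hh : Measurable h) :
    ∫⁻ r in Ioi (0 : ℝ), ENNReal.ofReal (r ^ (d - 1)) *
        (ENNReal.ofReal (K * Real.exp (-(q * r ^ 2))) * h r) =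
      ENNReal.ofReal (K * Real.Gamma (d / 2) / (2 * q ^ ((d : ℝ) / 2))) *
        ∫⁻ t, h (√t) ∂gammaMeasure ((d : ℝ) / 2) q := by
  have hd' : (0 : ℝ) < d / 2 := by positivity
  have hG : 0 < Real.Gamma (d / 2) := Real.Gamma_pos_of_pos hd'
  have hqd : 0 < q ^ ((d : ℝ) / 2) := Real.rpow_pos_of_pos hq _
  rw [lintegral_gammaMeasure _ _ (by fun_prop),
    lintegral_Ioi_comp_sq fun t => gammaPDF ((d : ℝ) / 2) q t * h (√t),
    ← lintegral_const_mul' _ _ ENNReal.ofReal_ne_top]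
  refine setLIntegral_congr_fun measurableSet_Ioi fun r hr => ?_
  have hr' : 0 < r := hr
  have hpow : (r ^ 2) ^ ((d : ℝ) / 2 - 1) * r = r ^ (d - 1) := by
    rw [← Real.rpow_natCast r 2, ← Real.rpow_mul hr'.le, ← Real.rpow_natCast r (d - 1),
      ← Real.rpow_add_one hr'.ne', Nat.cast_sub hd]
    congr 1
    push_cast
    ring
  rw [gammaPDF_of_nonneg (sq_nonneg r), Real.sqrt_sq hr'.le, ← mul_assoc, ← mul_assoc, ← mul_assoc,
    ← ENNReal.ofReal_mul (by positivity), ← ENNReal.ofReal_mul (by positivity),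
    ← ENNReal.ofReal_mul (by positivity)]
  congr 2
  rw [← hpow]
  field_simp

/-- Disintegration along rays of a measure whose density restricts to each ray from the origin as
a Gaussian. -/
lemma withDensity_inter_radialProj_preimage {E : Type*} [NormedAddCommGroup E] [NormedSpace ℝ E]
    [MeasurableSpace E] [BorelSpace E] [FiniteDimensional ℝ E] [Nontrivial E]
    (μ : Measure E) [μ.IsAddHaarMeasure] (z : E) {K : ℝ} (hK : 0 ≤ K) {Q : E → ℝ}
    (hQ : Measurable Q) (hQsmul : ∀ (r : ℝ) x, Q (r • x) = r ^ 2 * Q x)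
    (hQpos : ∀ x, x ≠ 0 → 0 < Q x) {A B : Set E} (hA : MeasurableSet A) (hB : MeasurableSet B) :
    (μ.withDensity fun x => ENNReal.ofReal (K * Real.exp (-Q x))) (A ∩ radialProj z ⁻¹' B) =
      ∫⁻ x in B, ((gammaMeasure ((Module.finrank ℝ E : ℝ) / 2) (Q x)).map fun t => √t • x) A
        ∂((μ.withDensity fun x => ENNReal.ofReal (K * Real.exp (-Q x))).map (radialProj z)) := by
  have hdim : 1 ≤ Module.finrank ℝ E := Module.finrank_pos
  have hP : Measurable (radialProj z) := measurable_radialProj z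
  have hPB := hP hB
  have hκ (x : E) : ((gammaMeasure ((Module.finrank ℝ E : ℝ) / 2) (Q x)).map fun t => √t • x) A =
      ∫⁻ t, A.indicator 1 (√t • x) ∂gammaMeasure ((Module.finrank ℝ E : ℝ) / 2) (Q x) := by
    rw [← lintegral_indicator_one hA, lintegral_map (measurable_one.indicator hA) (by fun_prop)]
  have h1A : Measurable (A.indicator (1 : E → ENNReal)) := measurable_one.indicator hA
  have h1B : Measurable (B.indicator (1 : E → ENNReal)) := measurable_one.indicator hB
  have hκm : Measurable fun x : E =>
      ((gammaMeasure ((Module.finrank ℝ E : ℝ) / 2) (Q x)).map fun t => √t • x) A := by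
    simp_rw [hκ]
    have hm (x : E) : Measurable fun t : ℝ => A.indicator (1 : E → ENNReal) (√t • x) := by fun_prop
    simp_rw [lintegral_gammaMeasure _ _ (hm _)]
    have hpdf : Measurable fun p : E × ℝ =>
        gammaPDF ((Module.finrank ℝ E : ℝ) / 2) (Q p.1) p.2 := by
      simp only [gammaPDF_eq]
      refine (Measurable.ite (measurableSet_le measurable_const measurable_snd) ?_
        measurable_const).ennreal_ofReal
      fun_prop
    exact Measurable.lintegral_prod_right' (f := fun p : E × ℝ =>
      gammaPDF ((Module.finrank ℝ E : ℝ) / 2) (Q p.1) p.2 * A.indicator 1 (√p.2 • p.1))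
      (hpdf.mul (by fun_prop))
  have hg : Measurable fun x : E => ENNReal.ofReal (K * Real.exp (-Q x)) := by fun_prop
  have hpolar {F : E → ENNReal} (hF : Measurable F) (s : Metric.sphere (0 : E) 1) :
      ∫⁻ r in Ioi (0 : ℝ), ENNReal.ofReal (r ^ (Module.finrank ℝ E - 1)) *
        (ENNReal.ofReal (K * Real.exp (-Q (r • (s : E)))) * F (r • (s : E))) =
      ENNReal.ofReal (K * Real.Gamma (Module.finrank ℝ E / 2) /
          (2 * Q s ^ ((Module.finrank ℝ E : ℝ) / 2))) *
        ∫⁻ t, F (√t • (s : E)) ∂gammaMeasure ((Module.finrank ℝ E : ℝ) / 2) (Q s) := by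
    rw [← lintegral_pow_mul_exp_neg_sq_eq_gammaMeasure hdim hK
      (hQpos s (ne_zero_of_mem_unit_sphere s)) (h := fun r => F (r • (s : E))) (by fun_prop)]
    simp_rw [hQsmul, mul_comm (Q _)]
  have hsqrt (s : Metric.sphere (0 : E) 1) :
      ∀ᵐ t ∂gammaMeasure ((Module.finrank ℝ E : ℝ) / 2) (Q s),
        radialProj z (√t • (s : E)) = s := by
    have hset : MeasurableSet {t : ℝ | radialProj z (√t • (s : E)) = s} :=
      (measurableSet_singleton (s : E)).preimage (hP.comp (by fun_prop))
    change gammaMeasure ((Module.finrank ℝ E : ℝ) / 2) (Q s)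
      {t : ℝ | radialProj z (√t • (s : E)) = s}ᶜ = 0
    rw [← lintegral_indicator_one hset.compl,
      lintegral_gammaMeasure _ _ (measurable_one.indicator hset.compl)]
    rw [setLIntegral_congr_fun (g := fun _ => 0) measurableSet_Ioi, lintegral_zero]
    intro t ht
    have : radialProj z (√t • (s : E)) = s :=
      radialProj_smul_of_pos z (norm_eq_of_mem_sphere s) (Real.sqrt_pos.2 ht)
    simp [this]
  have hset {F : E → ENNReal} (hF : Measurable F) :
      ∫⁻ x in radialProj z ⁻¹' B, F x ∂(μ.withDensity fun x => ENNReal.ofReal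
        (K * Real.exp (-Q x))) =
      ∫⁻ s : Metric.sphere (0 : E) 1, (ENNReal.ofReal (K * Real.Gamma (Module.finrank ℝ E / 2) /
          (2 * Q s ^ ((Module.finrank ℝ E : ℝ) / 2))) *
        (B.indicator 1 (s : E) *
          ∫⁻ t, F (√t • (s : E)) ∂gammaMeasure ((Module.finrank ℝ E : ℝ) / 2) (Q s)))
            ∂μ.toSphere := by
    have hFB : Measurable fun x => B.indicator (1 : E → ENNReal) (radialProj z x) * F x := by
      fun_prop
    have h1 : (radialProj z ⁻¹' B).indicator F =
        fun x => B.indicator (1 : E → ENNReal) (radialProj z x) * F x := by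
      ext x
      by_cases hx : radialProj z x ∈ B <;> simp [indicator, hx]
    rw [← lintegral_indicator hPB, h1, lintegral_withDensity_eq_lintegral_mul _ hg hFB,
      lintegral_eq_lintegral_toSphere_Ioi μ (hg.mul hFB)]
    refine lintegral_congr fun s => ?_
    simp only [Pi.mul_apply]
    rw [hpolar hFB s, ← lintegral_const_mul _ (f := fun t => F (√t • (s : E))) (by fun_prop)]
    congr 1
    refine lintegral_congr_ae ?_
    filter_upwards [hsqrt s] with t ht
    rw [ht]
  rw [setLIntegral_map hB hκm hP, ← Measure.restrict_apply hA, ← lintegral_indicator_one hA,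
    hset h1A]
  refine Eq.trans ?_ (hset (hκm.comp hP)).symm
  refine lintegral_congr fun s => ?_
  congr 2
  have hprob := isProbabilityMeasure_gammaMeasure
    (a := (Module.finrank ℝ E : ℝ) / 2) (by positivity) (hQpos s (ne_zero_of_mem_unit_sphere s))
  rw [← hκ s, lintegral_congr_ae (g := fun _ =>
    ((gammaMeasure ((Module.finrank ℝ E : ℝ) / 2) (Q s)).map fun t => √t • (s : E)) A)]
  · simp
  · filter_upwards [hsqrt s] with t ht
    simp only [Function.comp_apply, ht]

/-- **The conditional distribution of a centred Gaussian given its radial projection.**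
If `ν₀ = N(0, C)` on `ℝᵈ` and `R² ∼ Gam(d/2, x̄ᵀC⁻¹x̄/2)`, then `R x̄` is distributed according
to the conditional distribution of `X₀ ∼ ν₀` given `Π^S(X₀) = x̄`. -/
theorem gaussian_rcd_given_radial_projection
    (d : ℕ) (hd : 1 ≤ d) (C : Matrix (Fin d) (Fin d) ℝ) (hC : C.PosDef)
    (z : EuclideanSpace ℝ (Fin d)) (hz : ‖z‖ = 1)
    (ν₀ : Measure (EuclideanSpace ℝ (Fin d)))
    (hν₀ : ν₀ = volume.withDensity fun x => ENNReal.ofReal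
      ((2 * Real.pi) ^ (-(d : ℝ) / 2) * C.det ^ (-(1 : ℝ) / 2) *
        Real.exp (-(1 / 2 * ∑ i, ∑ j, x i * C⁻¹ i j * x j))))
    (A : Set (EuclideanSpace ℝ (Fin d))) (hA : MeasurableSet A)
    (B : Set (EuclideanSpace ℝ (Fin d))) (hB : MeasurableSet B)
    (hBS : B ⊆ Metric.sphere (0 : EuclideanSpace ℝ (Fin d)) 1) :
    ν₀ (A ∩ radialProj z ⁻¹' B) =
      ∫⁻ x in B,
        ((ProbabilityTheory.gammaMeasure ((d : ℝ) / 2)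
            (1 / 2 * ∑ i, ∑ j, x i * C⁻¹ i j * x j)).map
          (fun t => Real.sqrt t • x)) A ∂(ν₀.map (radialProj z)) := by
  have : Nonempty (Fin d) := ⟨⟨0, hd⟩⟩
  have hQpos (x : EuclideanSpace ℝ (Fin d)) (hx : x ≠ 0) :
      0 < 1 / 2 * ∑ i, ∑ j, x i * C⁻¹ i j * x j := by
    have hx' : x.ofLp ≠ 0 := fun h => hx (by ext i; exact congrFun h i)
    have := hC.inv.dotProduct_mulVec_pos hx'
    simp only [dotProduct, Matrix.mulVec, Finset.mul_sum, Pi.star_apply, star_trivial,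
      ← mul_assoc] at this
    linarith
  have key := withDensity_inter_radialProj_preimage
    (volume : Measure (EuclideanSpace ℝ (Fin d))) z
    (K := (2 * Real.pi) ^ (-(d : ℝ) / 2) * C.det ^ (-(1 : ℝ) / 2))
    (Q := fun x => 1 / 2 * ∑ i, ∑ j, x i * C⁻¹ i j * x j)
    (by have := hC.det_pos; positivity) (by fun_prop)
    (fun r x => by
      simp only [PiLp.smul_apply, smul_eq_mul, Finset.mul_sum]
      refine Finset.sum_congr rfl fun i _ => Finset.sum_congr rfl fun j _ => ?_
      ring)
    hQpos hA hB
  rw [finrank_euclideanSpace_fin] at key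
  rw [hν₀]
  exact key
end

section
/- Let X and Y be standard Borel (Polish) spaces, T : X → Y measurable, ν a probability measure on X, μ := T♯ν, and let K be a Markov kernel on X that is reversible with respect to ν, i.e. ∫_A K(x, B) ν(dx) = ∫_B K(x, A) ν(dx) for all measurable A, B ⊆ X. Then the push-forward kernel T♯K, defined by T♯K(ȳ, Ā) := ∫_X K(x, T⁻¹(Ā)) ν_{|T}(ȳ, dx), is reversible with respect to μ: for all measurable Ā, B̄ ⊆ Y, ∫_Ā (T♯K)(ȳ, B̄) μ(dȳ) = ∫_B̄ (T♯K)(ȳ, Ā) μ(dȳ). -/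
open MeasureTheory ProbabilityTheory

/-- If `κ` disintegrates `ν` along `T`, then restricting `ν` to `T ⁻¹' B` amounts to mixing `κ`
over `B`. -/
theorem restrict_preimage_eq_bind_of_disintegration {X Y : Type*}
    [MeasurableSpace X] [MeasurableSpace Y] (T : X → Y) (ν : Measure X) (μ : Measure Y)
    (κ : Kernel Y X)
    (hκ : ∀ (A : Set X) (B : Set Y), MeasurableSet A → MeasurableSet B →
      ν (A ∩ T ⁻¹' B) = ∫⁻ y in B, κ y A ∂μ)
    {B : Set Y} (hB : MeasurableSet B) :
    ν.restrict (T ⁻¹' B) = (μ.restrict B).bind κ := by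
  ext A hA
  rw [Measure.restrict_apply hA, Measure.bind_apply hA κ.measurable.aemeasurable, hκ A B hA hB]

/-- Integrating against the kernels of a disintegration of `ν` along `T` over `B` is integrating
against `ν` over `T ⁻¹' B`. -/
theorem setLIntegral_lintegral_of_disintegration {X Y : Type*}
    [MeasurableSpace X] [MeasurableSpace Y] (T : X → Y) (ν : Measure X) (μ : Measure Y)
    (κ : Kernel Y X)
    (hκ : ∀ (A : Set X) (B : Set Y), MeasurableSet A → MeasurableSet B →
      ν (A ∩ T ⁻¹' B) = ∫⁻ y in B, κ y A ∂μ)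
    {B : Set Y} (hB : MeasurableSet B) {f : X → ENNReal} (hf : Measurable f) :
    ∫⁻ y in B, (∫⁻ x, f x ∂(κ y)) ∂μ = ∫⁻ x in T ⁻¹' B, f x ∂ν := by
  rw [restrict_preimage_eq_bind_of_disintegration T ν μ κ hκ hB,
    Measure.lintegral_bind κ.measurable.aemeasurable hf.aemeasurable]

/-- **Reversibility is inherited by push-forward kernels.**
If `K` is reversible with respect to `ν`, then the push-forward kernel
`T♯K(ȳ, Ā) = ∫ K(x, T⁻¹ Ā) ν_{|T}(ȳ, dx)` is reversible with respect to `μ = T♯ν`. -/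
theorem pushforward_kernel_reversible {X Y : Type*}
    [MeasurableSpace X] [StandardBorelSpace X]
    [MeasurableSpace Y] [StandardBorelSpace Y]
    (T : X → Y) (hT : Measurable T)
    (ν : Measure X) [IsProbabilityMeasure ν]
    (μ : Measure Y) (hμ : μ = ν.map T)
    (K : Kernel X X) [IsMarkovKernel K]
    (hrev : ∀ (A B : Set X), MeasurableSet A → MeasurableSet B →
      ∫⁻ x in A, K x B ∂ν = ∫⁻ x in B, K x A ∂ν)
    (κ : Kernel Y X) [IsMarkovKernel κ]
    (hκ : ∀ (A : Set X) (B : Set Y), MeasurableSet A → MeasurableSet B →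
      ν (A ∩ T ⁻¹' B) = ∫⁻ y in B, κ y A ∂μ) :
    ∀ (A B : Set Y), MeasurableSet A → MeasurableSet B →
      ∫⁻ y in A, (∫⁻ x, K x (T ⁻¹' B) ∂(κ y)) ∂μ =
        ∫⁻ y in B, (∫⁻ x, K x (T ⁻¹' A) ∂(κ y)) ∂μ := by
  intro A B hA hB
  rw [setLIntegral_lintegral_of_disintegration T ν μ κ hκ hA (K.measurable_coe (hT hB)),
    setLIntegral_lintegral_of_disintegration T ν μ κ hκ hB (K.measurable_coe (hT hA))]
  exact hrev _ _ (hT hA) (hT hB)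
end

section
/- Let X and Y be standard Borel (Polish) spaces, T : X → Y measurable, ν a probability measure on X, μ := T♯ν, and let K be a Markov kernel on X that is invariant with respect to ν (i.e. ∫_X K(x, A) ν(dx) = ν(A) for all measurable A). Define the push-forward kernel T♯K(ȳ, Ā) := ∫_X K(x, T⁻¹(Ā)) ν_{|T}(ȳ, dx). Suppose there exists κ ∈ [0, 1) such that for every bounded measurable f : X → ℝ with ∫_X f dν = 0 one has ∫_X (∫_X f(y) K(x, dy))² ν(dx) ≤ κ² ∫_X f² dν. Then for every bounded measurable g : Y → ℝ with ∫_Y g dμ = 0 one has ∫_Y (∫_Y g(z̄) (T♯K)(ȳ, dz̄))² μ(dȳ) ≤ κ² ∫_Y g² dμ; in particular the push-forward kernel has an L²(μ)-spectral gap at least as large as the L²(ν)-spectral gap of K. -/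
open MeasureTheory ProbabilityTheory

theorem abs_integral_le_of_abs_le {α : Type*} [MeasurableSpace α] {m : Measure α}
    [IsProbabilityMeasure m] {f : α → ℝ} {M : ℝ} (hM : ∀ a, |f a| ≤ M) :
    |∫ a, f a ∂m| ≤ M := by
  simpa using norm_integral_le_of_norm_le_const (μ := m) (f := f) (C := M)
    (Filter.Eventually.of_forall hM)

theorem integrable_of_abs_le {α : Type*} [MeasurableSpace α] {m : Measure α}
    [IsFiniteMeasure m] {f : α → ℝ} {M : ℝ} (hf : Measurable f) (hM : ∀ a, |f a| ≤ M) :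
    Integrable f m :=
  Integrable.of_bound hf.aestronglyMeasurable M (Filter.Eventually.of_forall hM)

theorem abs_sq_le_sq_of_abs_le {a M : ℝ} (h : |a| ≤ M) : |a ^ 2| ≤ M ^ 2 := by
  rw [abs_pow]
  exact pow_le_pow_left₀ (abs_nonneg a) h 2

/-- Jensen's inequality for the square of a bounded function. -/
theorem sq_integral_le_integral_sq {α : Type*} [MeasurableSpace α] {m : Measure α}
    [IsProbabilityMeasure m] {f : α → ℝ} {M : ℝ} (hf : Measurable f) (hM : ∀ a, |f a| ≤ M) :
    (∫ a, f a ∂m) ^ 2 ≤ ∫ a, f a ^ 2 ∂m :=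
  (Even.convexOn_pow (n := 2) even_two).map_integral_le (continuous_pow 2).continuousOn
    isClosed_univ (Filter.Eventually.of_forall fun _ => Set.mem_univ _) (integrable_of_abs_le hf hM)
    (integrable_of_abs_le (hf.pow_const 2) fun a => abs_sq_le_sq_of_abs_le (hM a))

/-- Averaging over a Markov kernel contracts the `L²`-norm. -/
theorem integral_sq_integral_kernel_le {X Y : Type*} [MeasurableSpace X] [MeasurableSpace Y]
    (μ : Measure Y) [IsProbabilityMeasure μ] (η : Kernel Y X) [IsMarkovKernel η]
    {h : X → ℝ} {M : ℝ} (hh : Measurable h) (hM : ∀ x, |h x| ≤ M) :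
    ∫ y, (∫ x, h x ∂(η y)) ^ 2 ∂μ ≤ ∫ x, h x ^ 2 ∂(η ∘ₘ μ) := by
  have hh2 : Measurable fun x => h x ^ 2 := hh.pow_const 2
  have hM2 : ∀ x, |h x ^ 2| ≤ M ^ 2 := fun x => abs_sq_le_sq_of_abs_le (hM x)
  have hcomp : ∫ x, h x ^ 2 ∂(η ∘ₘ μ) = ∫ y, ∫ x, h x ^ 2 ∂(η y) ∂μ := by
    simpa [Kernel.comp_apply] using
      Kernel.integral_comp (η := η) (κ := Kernel.const Unit μ) (a := ())
        (integrable_of_abs_le hh2 hM2)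
  rw [hcomp]
  refine integral_mono
    (integrable_of_abs_le (hh.stronglyMeasurable.integral_kernel.measurable.pow_const 2)
      fun y => abs_sq_le_sq_of_abs_le (abs_integral_le_of_abs_le hM))
    (integrable_of_abs_le hh2.stronglyMeasurable.integral_kernel.measurable
      fun y => abs_integral_le_of_abs_le hM2)
    fun y => sq_integral_le_integral_sq hh hM

/-- **The push-forward kernel inherits the `L²`-spectral gap.**
If the `ν`-invariant kernel `K` contracts mean-zero bounded functions in `L²(ν)` by a factor
`κ < 1`, then the push-forward kernel `T♯K` contracts mean-zero bounded functions in
`L²(μ)`, `μ = T♯ν`, by the same factor; i.e. `gap_μ(T♯K) ≥ gap_ν(K)`. -/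
theorem pushforward_kernel_spectral_gap {X Y : Type*}
    [MeasurableSpace X] [StandardBorelSpace X]
    [MeasurableSpace Y] [StandardBorelSpace Y]
    (T : X → Y) (hT : Measurable T)
    (ν : Measure X) [IsProbabilityMeasure ν]
    (μ : Measure Y) (hμ : μ = ν.map T)
    (K : Kernel X X) [IsMarkovKernel K]
    (hinv : ∀ A : Set X, MeasurableSet A → ∫⁻ x, K x A ∂ν = ν A)
    (νT : Kernel Y X) [IsMarkovKernel νT]
    (hνT : ∀ (A : Set X) (B : Set Y), MeasurableSet A → MeasurableSet B →
      ν (A ∩ T ⁻¹' B) = ∫⁻ y in B, νT y A ∂μ)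
    (TK : Kernel Y Y) [IsMarkovKernel TK]
    (hTK : ∀ (y : Y) (A : Set Y), MeasurableSet A →
      TK y A = ∫⁻ x, K x (T ⁻¹' A) ∂(νT y))
    (κ : ℝ) (hκ0 : 0 ≤ κ) (hκ1 : κ < 1)
    (hgap : ∀ f : X → ℝ, Measurable f → (∃ M, ∀ x, |f x| ≤ M) → (∫ x, f x ∂ν = 0) →
      ∫ x, (∫ y, f y ∂(K x)) ^ 2 ∂ν ≤ κ ^ 2 * ∫ x, (f x) ^ 2 ∂ν) :
    ∀ g : Y → ℝ, Measurable g → (∃ M, ∀ y, |g y| ≤ M) → (∫ y, g y ∂μ = 0) →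
      ∫ y, (∫ z, g z ∂(TK y)) ^ 2 ∂μ ≤ κ ^ 2 * ∫ y, (g y) ^ 2 ∂μ := by
  rintro g hg ⟨M, hM⟩ hg0
  have hgT : Measurable fun x => g (T x) := hg.comp hT
  have : IsProbabilityMeasure μ := hμ ▸ Measure.isProbabilityMeasure_map hT.aemeasurable
  have hνcomp : νT ∘ₘ μ = ν := by
    ext A hA
    rw [Measure.bind_apply hA νT.aemeasurable]
    simpa using (hνT A Set.univ hA MeasurableSet.univ).symm
  have hTKcomp : TK = K.map T ∘ₖ νT := by
    ext y A hA
    rw [hTK y A hA, Kernel.comp_apply' _ _ _ hA]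
    exact lintegral_congr fun x => (Kernel.map_apply' K hT x hA).symm
  have : IsMarkovKernel (K.map T) := Kernel.IsMarkovKernel.map K hT
  have hTKg : ∀ y, ∫ z, g z ∂(TK y) = ∫ x, ∫ x', g (T x') ∂(K x) ∂(νT y) := fun y => by
    rw [hTKcomp, Kernel.integral_comp (integrable_of_abs_le hg hM)]
    refine integral_congr_ae (Filter.Eventually.of_forall fun x => ?_)
    simp only [Kernel.map_apply K hT]
    exact integral_map hT.aemeasurable hg.aestronglyMeasurable
  have hmap : ∀ f : Y → ℝ, Measurable f → ∫ y, f y ∂μ = ∫ x, f (T x) ∂ν := fun f hf => by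
    rw [hμ, integral_map hT.aemeasurable hf.aestronglyMeasurable]
  calc ∫ y, (∫ z, g z ∂(TK y)) ^ 2 ∂μ
      = ∫ y, (∫ x, ∫ x', g (T x') ∂(K x) ∂(νT y)) ^ 2 ∂μ := by simp_rw [hTKg]
    _ ≤ ∫ x, (∫ x', g (T x') ∂(K x)) ^ 2 ∂(νT ∘ₘ μ) :=
        integral_sq_integral_kernel_le μ νT
          hgT.stronglyMeasurable.integral_kernel.measurable
          fun x => abs_integral_le_of_abs_le fun x' => hM (T x')
    _ = ∫ x, (∫ x', g (T x') ∂(K x)) ^ 2 ∂ν := by rw [hνcomp]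
    _ ≤ κ ^ 2 * ∫ x, g (T x) ^ 2 ∂ν :=
        hgap _ hgT ⟨M, fun x => hM (T x)⟩ (by rw [← hmap g hg, hg0])
    _ = κ ^ 2 * ∫ y, g y ^ 2 ∂μ := by rw [hmap _ (hg.pow_const 2)]
end

section
/- Let X and Y be standard Borel (Polish) spaces, T : X → Y measurable, ν a probability measure on X, μ := T♯ν. Let Q be a Markov kernel on X, let ᾱ : Y × Y → [0, 1] be measurable, set α(x, y) := ᾱ(T(x), T(y)), and let K be the Metropolis–Hastings kernel K(x, A) := ∫_A α(x, y) Q(x, dy) + (1 − ∫_X α(x, y) Q(x, dy)) 𝟙_A(x). Define Q̄(ȳ, Ā) := ∫_X Q(x, T⁻¹(Ā)) ν_{|T}(ȳ, dx) and the push-forward kernel T♯K(ȳ, Ā) := ∫_X K(x, T⁻¹(Ā)) ν_{|T}(ȳ, dx). Then for μ-almost every ȳ ∈ Y and every measurable Ā ⊆ Y, (T♯K)(ȳ, Ā) = ∫_Ā ᾱ(ȳ, z̄) Q̄(ȳ, dz̄) + (1 − ∫_Y ᾱ(ȳ, z̄) Q̄(ȳ, dz̄)) 𝟙_Ā(ȳ);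 that is, T♯K is the Metropolis–Hastings kernel on Y with proposal kernel Q̄ and acceptance probability ᾱ. -/
open MeasureTheory ProbabilityTheory
open scoped ENNReal

/-- A disintegration of `ν` along `T` is, for almost every `y`, concentrated on the fibre of `T`
over `y`. -/
theorem ae_ae_eq_of_disintegration {X Y : Type*} [MeasurableSpace X] [MeasurableSpace Y]
    [StandardBorelSpace Y] {T : X → Y} (hT : Measurable T) {ν : Measure X}
    [IsProbabilityMeasure ν] {νT : Kernel Y X} [IsMarkovKernel νT]
    (hνT : ∀ (A : Set X) (B : Set Y), MeasurableSet A → MeasurableSet B →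
      ν (A ∩ T ⁻¹' B) = ∫⁻ y in B, νT y A ∂(ν.map T)) :
    ∀ᵐ y ∂(ν.map T), ∀ᵐ x ∂(νT y), T x = y := by
  have : IsProbabilityMeasure (ν.map T) := Measure.isProbabilityMeasure_map hT.aemeasurable
  have hgraph : Measurable fun x => (T x, x) := hT.prodMk measurable_id
  have heq : ν.map (fun x => (T x, x)) = (ν.map T) ⊗ₘ νT := by
    refine Measure.ext_prod fun {B A} hB hA => ?_
    rw [Measure.map_apply hgraph (hB.prod hA), Measure.compProd_apply_prod hB hA, ← hνT A B hA hB]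
    congr 1
    ext x
    simp [and_comm]
  refine Measure.ae_ae_of_ae_compProd (p := fun q : Y × X => T q.2 = q.1) ?_
  rw [← heq]
  refine (ae_map_iff hgraph.aemeasurable
    (measurableSet_eq_fun (hT.comp measurable_snd) measurable_fst)).2 ?_
  exact Filter.Eventually.of_forall fun _ => rfl

/-- Set integrals against the `m`-average of the push-forwards of `Q x` under `T`. -/
theorem setLIntegral_of_eq_average {X Y : Type*} [MeasurableSpace X] [MeasurableSpace Y]
    {T : X → Y} (hT : Measurable T) {m : Measure X} {Q : Kernel X X} {q : Measure Y}
    (hq : ∀ A, MeasurableSet A → q A = ∫⁻ x, Q x (T ⁻¹' A) ∂m)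
    {f : Y → ℝ≥0∞} (hf : Measurable f) {A : Set Y} (hA : MeasurableSet A) :
    ∫⁻ z in A, f z ∂q = ∫⁻ x, ∫⁻ z in T ⁻¹' A, f (T z) ∂(Q x) ∂m := by
  have hbind : q = m.bind (Q.map T) := by
    ext B hB
    rw [hq B hB, Measure.bind_apply hB (Kernel.aemeasurable _)]
    simp_rw [Kernel.map_apply' Q hT _ hB]
  rw [hbind, ← lintegral_indicator hA,
    Measure.lintegral_bind (Kernel.aemeasurable _) (hf.indicator hA).aemeasurable]
  refine lintegral_congr fun x => ?_
  rw [Kernel.map_apply _ hT, lintegral_indicator hA, setLIntegral_map hA hf hT]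

/-- **The push-forward of a Metropolis–Hastings kernel is a Metropolis–Hastings kernel.**
If `K` is the MH kernel on `X` with proposal `Q` and acceptance probability
`α(x, y) = ᾱ(T x, T y)`, then the push-forward kernel `T♯K` is (μ-a.e.) the MH kernel on `Y`
with proposal `Q̄(ȳ, Ā) = ∫ Q(x, T⁻¹ Ā) ν_{|T}(ȳ, dx)` and acceptance probability `ᾱ`. -/
theorem pushforward_MH_kernel_is_MH {X Y : Type*}
    [MeasurableSpace X] [StandardBorelSpace X]
    [MeasurableSpace Y] [StandardBorelSpace Y]
    (T : X → Y) (hT : Measurable T)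
    (ν : Measure X) [IsProbabilityMeasure ν]
    (μ : Measure Y) (hμ : μ = ν.map T)
    (Q : Kernel X X) [IsMarkovKernel Q]
    (α : Y → Y → ℝ) (hα_meas : Measurable (Function.uncurry α))
    (hα_mem : ∀ y z, α y z ∈ Set.Icc (0 : ℝ) 1)
    (K : Kernel X X)
    (hK : ∀ (x : X) (A : Set X), MeasurableSet A →
      K x A = (∫⁻ y in A, ENNReal.ofReal (α (T x) (T y)) ∂(Q x)) +
        (1 - ∫⁻ y, ENNReal.ofReal (α (T x) (T y)) ∂(Q x)) *
          A.indicator (fun _ => (1 : ℝ≥0∞)) x)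
    (νT : Kernel Y X) [IsMarkovKernel νT]
    (hνT : ∀ (A : Set X) (B : Set Y), MeasurableSet A → MeasurableSet B →
      ν (A ∩ T ⁻¹' B) = ∫⁻ y in B, νT y A ∂μ)
    (Qb : Kernel Y Y) [IsMarkovKernel Qb]
    (hQb : ∀ (y : Y) (A : Set Y), MeasurableSet A →
      Qb y A = ∫⁻ x, Q x (T ⁻¹' A) ∂(νT y)) :
    ∀ᵐ y ∂μ, ∀ A : Set Y, MeasurableSet A →
      (∫⁻ x, K x (T ⁻¹' A) ∂(νT y)) =
        (∫⁻ z in A, ENNReal.ofReal (α y z) ∂(Qb y)) +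
          (1 - ∫⁻ z, ENNReal.ofReal (α y z) ∂(Qb y)) *
            A.indicator (fun _ => (1 : ℝ≥0∞)) y := by
  subst hμ
  filter_upwards [ae_ae_eq_of_disintegration hT hνT] with y hy A hA
  have hf : Measurable fun z => ENNReal.ofReal (α y z) :=
    (hα_meas.comp measurable_prodMk_left).ennreal_ofReal
  have hfT : Measurable fun z => ENNReal.ofReal (α y (T z)) := hf.comp hT
  have htotal : ∫⁻ z, ENNReal.ofReal (α y z) ∂(Qb y) =
      ∫⁻ x, ∫⁻ z, ENNReal.ofReal (α y (T z)) ∂(Q x) ∂(νT y) := by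
    simpa using setLIntegral_of_eq_average hT (hQb y) hf MeasurableSet.univ
  have hle (x : X) : ∫⁻ z, ENNReal.ofReal (α y (T z)) ∂(Q x) ≤ 1 :=
    (lintegral_mono fun z => ENNReal.ofReal_le_one.2 (hα_mem y (T z)).2).trans (by simp)
  have hmeas : Measurable fun x => ∫⁻ z, ENNReal.ofReal (α y (T z)) ∂(Q x) :=
    hfT.lintegral_kernel
  have hmeasA : Measurable fun x => ∫⁻ z in T ⁻¹' A, ENNReal.ofReal (α y (T z)) ∂(Q x) :=
    hfT.setLIntegral_kernel (hT hA)
  have hfin : ∫⁻ x, ∫⁻ z, ENNReal.ofReal (α y (T z)) ∂(Q x) ∂(νT y) ≠ ∞ :=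
    ((lintegral_mono hle).trans_lt (by simp)).ne
  calc ∫⁻ x, K x (T ⁻¹' A) ∂(νT y)
      = ∫⁻ x, ((∫⁻ z in T ⁻¹' A, ENNReal.ofReal (α y (T z)) ∂(Q x)) +
          (1 - ∫⁻ z, ENNReal.ofReal (α y (T z)) ∂(Q x)) *
            A.indicator (fun _ => (1 : ℝ≥0∞)) y) ∂(νT y) := by
        refine lintegral_congr_ae (hy.mono fun x hx => ?_)
        simp only [hK x _ (hT hA), ← hx]
        rfl
    _ = _ := by
        rw [lintegral_add_left hmeasA, lintegral_mul_const _ (hmeas.const_sub 1),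
          lintegral_sub hmeas hfin (Filter.Eventually.of_forall hle),
          setLIntegral_of_eq_average hT (hQb y) hf hA, htotal]
        simp
end

section
/- Let X and Y be standard Borel (Polish) spaces, T : X → Y measurable, ν a probability measure on X, μ := T♯ν, and let K be a Markov kernel on X that is invariant with respect to ν, i.e. ∫_X K(x, A) ν(dx) = ν(A) for all measurable A ⊆ X. Then the push-forward kernel T♯K, defined by T♯K(ȳ, Ā) := ∫_X K(x, T⁻¹(Ā)) ν_{|T}(ȳ, dx), is invariant with respect to μ: for every measurable Ā ⊆ Y, ∫_Y (T♯K)(ȳ, Ā) μ(dȳ) = μ(Ā). -/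
open MeasureTheory ProbabilityTheory

/-- **Invariance is inherited by push-forward kernels.**
If `K` is invariant with respect to `ν`, then the push-forward kernel
`T♯K(ȳ, Ā) = ∫ K(x, T⁻¹ Ā) ν_{|T}(ȳ, dx)` is invariant with respect to `μ = T♯ν`. -/
theorem pushforward_kernel_invariant {X Y : Type*}
    [MeasurableSpace X] [StandardBorelSpace X]
    [MeasurableSpace Y] [StandardBorelSpace Y]
    (T : X → Y) (hT : Measurable T)
    (ν : Measure X) [IsProbabilityMeasure ν]
    (μ : Measure Y) (hμ : μ = ν.map T)
    (K : Kernel X X) [IsMarkovKernel K]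
    (hinv : ∀ A : Set X, MeasurableSet A → ∫⁻ x, K x A ∂ν = ν A)
    (κ : Kernel Y X) [IsMarkovKernel κ]
    (hκ : ∀ (A : Set X) (B : Set Y), MeasurableSet A → MeasurableSet B →
      ν (A ∩ T ⁻¹' B) = ∫⁻ y in B, κ y A ∂μ) :
    ∀ A : Set Y, MeasurableSet A →
      ∫⁻ y, (∫⁻ x, K x (T ⁻¹' A) ∂(κ y)) ∂μ = μ A := by
  have hbind : μ.bind κ = ν := by
    ext A hA
    rw [Measure.bind_apply hA κ.aemeasurable]
    simpa using (hκ A Set.univ hA MeasurableSet.univ).symm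
  intro A hA
  have hTA : MeasurableSet (T ⁻¹' A) := hT hA
  rw [← Measure.lintegral_bind κ.aemeasurable (K.measurable_coe hTA).aemeasurable, hbind,
    hinv _ hTA, hμ, Measure.map_apply hT hA]
end

section
/- Let X be a measurable space, μ₀ a σ-finite measure on X, and Φ : X → ℝ measurable with Z := ∫_X exp(−Φ(x)) μ₀(dx) ∈ (0, ∞). Define the probability measure μ by dμ/dμ₀ = Z⁻¹ exp(−Φ), and for s > 0 define the super-level set X_s := {x ∈ X : exp(−Φ(x)) ≥ s}. Assume that 0 < μ₀(X_s) < ∞ for every s > 0 with s < exp(−Φ(x)) for some x ∈ X. Then the idealised slice sampling transition kernel K(x, A) := exp(Φ(x)) ∫₀^{exp(−Φ(x))} μ₀(A ∩ X_s)/μ₀(X_s) ds is reversible with respect to μ: for all measurable A, B ⊆ X, ∫_A K(x, B) μ(dx) = ∫_B K(x, A) μ(dx). -/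
open MeasureTheory
open scoped ENNReal

/-- The measure of `A` intersected with a super-level set of `f` is measurable in the level. -/
lemma measurable_measure_inter_superlevel {X : Type*} [MeasurableSpace X] (ν : Measure X)
    (f : X → ℝ) (A : Set X) : Measurable fun s : ℝ => ν (A ∩ {y | s ≤ f y}) :=
  Antitone.measurable fun _ _ hst =>
    measure_mono (Set.inter_subset_inter_right A fun _ hy => le_trans hst hy)

/-- A weighted layer cake formula over a set. -/
lemma setLIntegral_lintegral_Ioo_eq {X : Type*} [MeasurableSpace X] (ν : Measure X) [SFinite ν]
    {f : X → ℝ} (hf : Measurable f) {g : ℝ → ℝ≥0∞} (hg : Measurable g) (A : Set X) :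
    ∫⁻ x in A, (∫⁻ s in Set.Ioo (0 : ℝ) (f x), g s) ∂ν =
      ∫⁻ s in Set.Ioi (0 : ℝ), g s * ν (A ∩ {y | s ≤ f y}) := by
  have inner_eq (x : X) : ∫⁻ s in Set.Ioo (0 : ℝ) (f x), g s =
      ∫⁻ s in Set.Ioi (0 : ℝ), {p : X × ℝ | p.2 ≤ f p.1}.indicator (fun p => g p.2) (x, s) := by
    rw [setLIntegral_congr (Ioo_ae_eq_Ioc (μ := volume)), ← Set.Ioi_inter_Iic,
      Set.inter_comm, ← setLIntegral_indicator measurableSet_Iic]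
    rfl
  have hmeas : Measurable ({p : X × ℝ | p.2 ≤ f p.1}.indicator fun p => g p.2) :=
    (hg.comp measurable_snd).indicator
      (measurableSet_le measurable_snd (hf.comp measurable_fst))
  simp_rw [inner_eq]
  rw [lintegral_lintegral_swap (f := fun x s =>
    {p : X × ℝ | p.2 ≤ f p.1}.indicator (fun p => g p.2) (x, s)) hmeas.aemeasurable]
  refine lintegral_congr fun s => ?_
  have hlev : MeasurableSet {y | s ≤ f y} := measurableSet_le measurable_const hf
  change ∫⁻ x in A, {y | s ≤ f y}.indicator (fun _ => g s) x ∂ν = _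
  rw [lintegral_indicator_const hlev, Measure.restrict_apply hlev, Set.inter_comm]

/-- **Reversibility of idealised slice sampling.**
For a target `μ` with density `Z⁻¹ exp(−Φ)` with respect to a σ-finite reference measure
`μ₀`, the idealised slice sampling transition kernel
`K(x, A) = exp(Φ(x)) ∫₀^{exp(−Φ(x))} μ₀(A ∩ X_s)/μ₀(X_s) ds` (where `X_s` is the super-level
set of `exp(−Φ)` to level `s`) is reversible with respect to `μ`. -/
theorem slice_sampling_reversible {X : Type*} [MeasurableSpace X]
    (μ₀ : Measure X) [SigmaFinite μ₀]
    (Φ : X → ℝ) (hΦ : Measurable Φ)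
    (Z : ℝ≥0∞) (hZ : Z = ∫⁻ x, ENNReal.ofReal (Real.exp (-(Φ x))) ∂μ₀)
    (hZ0 : Z ≠ 0) (hZtop : Z ≠ ⊤)
    (μ : Measure X)
    (hμ : μ = μ₀.withDensity fun x => Z⁻¹ * ENNReal.ofReal (Real.exp (-(Φ x))))
    (hlevel : ∀ s : ℝ, 0 < s → (∃ x, s < Real.exp (-(Φ x))) →
      0 < μ₀ {y | s ≤ Real.exp (-(Φ y))} ∧ μ₀ {y | s ≤ Real.exp (-(Φ y))} < ⊤)
    (K : X → Set X → ℝ≥0∞)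
    (hK : ∀ (x : X) (A : Set X),
      K x A = ENNReal.ofReal (Real.exp (Φ x)) *
        ∫⁻ s in Set.Ioo (0 : ℝ) (Real.exp (-(Φ x))),
          μ₀ (A ∩ {y | s ≤ Real.exp (-(Φ y))}) / μ₀ {y | s ≤ Real.exp (-(Φ y))}) :
    ∀ (A B : Set X), MeasurableSet A → MeasurableSet B →
      ∫⁻ x in A, K x B ∂μ = ∫⁻ x in B, K x A ∂μ := by
  have key (A B : Set X) (hA : MeasurableSet A) : ∫⁻ x in A, K x B ∂μ =
      Z⁻¹ * ∫⁻ s in Set.Ioi (0 : ℝ), μ₀ (B ∩ {y | s ≤ Real.exp (-(Φ y))}) /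
        μ₀ {y | s ≤ Real.exp (-(Φ y))} * μ₀ (A ∩ {y | s ≤ Real.exp (-(Φ y))}) := by
    have hexp : Measurable fun x => Real.exp (-(Φ x)) := Real.measurable_exp.comp hΦ.neg
    have hZinv : Z⁻¹ ≠ ⊤ := ENNReal.inv_ne_top.2 hZ0
    have hlev : Measurable fun s : ℝ => μ₀ {y | s ≤ Real.exp (-(Φ y))} := by
      simpa using measurable_measure_inter_superlevel μ₀ (fun y => Real.exp (-(Φ y))) Set.univ
    have hratio : Measurable fun s : ℝ => μ₀ (B ∩ {y | s ≤ Real.exp (-(Φ y))}) /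
        μ₀ {y | s ≤ Real.exp (-(Φ y))} :=
      (measurable_measure_inter_superlevel μ₀ _ B).div hlev
    rw [← setLIntegral_lintegral_Ioo_eq μ₀ hexp hratio A,
      ← lintegral_const_mul' _ _ hZinv, hμ,
      setLIntegral_withDensity_eq_setLIntegral_mul_non_measurable μ₀
        (hexp.ennreal_ofReal.const_mul _) _ hA
        (Filter.Eventually.of_forall fun x => ENNReal.mul_lt_top hZinv.lt_top ENNReal.ofReal_lt_top)]
    refine lintegral_congr fun x => ?_
    have hone : ENNReal.ofReal (Real.exp (-(Φ x))) * ENNReal.ofReal (Real.exp (Φ x)) = 1 := by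
      rw [← ENNReal.ofReal_mul (Real.exp_nonneg _), ← Real.exp_add]
      simp
    rw [Pi.mul_apply, hK, mul_assoc, ← mul_assoc (ENNReal.ofReal _), hone, one_mul]
  intro A B hA hB
  rw [key A B hA, key B A hB]
  congr 1
  refine lintegral_congr fun s => ?_
  simp only [div_eq_mul_inv]
  ring
end
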